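/- If f₀ : (ℂ²,0) → (ℂ,0) is a germ with isolated singularity and (f_s) is an analytic deformation of f₀ through isolated singularities, then μ(f_s) ≤ μ(f₀) for all sufficiently small s, and μ(f_s) is constant for sufficiently small s ≠ 0. -/

import Mathlib

open MvPolynomial

/-- The Jacobian ideal of `f` in the ring of formal power series `ℂ[[x,y]]`. -/
noncomputable def jacobianIdeal (f : MvPolynomial (Fin 2) ℂ) :
    Ideal (MvPowerSeries (Fin 2) ℂ) :=
  Ideal.span {((pderiv 0 f : MvPolynomial (Fin 2) ℂ) : MvPowerSeries (Fin 2) ℂ),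
              ((pderiv 1 f : MvPolynomial (Fin 2) ℂ) : MvPowerSeries (Fin 2) ℂ)}

/-- The local Milnor number at the origin: `dim_ℂ ℂ[[x,y]]/(∂f/∂x, ∂f/∂y)`. -/
noncomputable def milnor (f : MvPolynomial (Fin 2) ℂ) : ℕ :=
  Module.finrank ℂ (MvPowerSeries (Fin 2) ℂ ⧸ jacobianIdeal f)

/-- `f` is a germ `(ℂ²,0) → (ℂ,0)` with an isolated singularity at the origin:
`f(0) = 0`, the origin is a critical point, and the Milnor algebra is finite-dimensional. -/
def IsIsolatedSingularity (f : MvPolynomial (Fin 2) ℂ) : Prop :=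
  coeff 0 f = 0 ∧ coeff 0 (pderiv 0 f) = 0 ∧ coeff 0 (pderiv 1 f) = 0 ∧
    FiniteDimensional ℂ (MvPowerSeries (Fin 2) ℂ ⧸ jacobianIdeal f)

namespace MilnorAux

open Filter Topology

/-- Abbreviation for the ring of formal power series in two variables. -/
abbrev R2 := MvPowerSeries (Fin 2) ℂ

/-- The ideal of power series of order at least `N`. -/
noncomputable def ordIdeal (N : ℕ) : Ideal R2 where
  carrier := {p | ∀ d : Fin 2 →₀ ℕ, d.degree < N → MvPowerSeries.coeff d p = 0}
  add_mem' := by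
    intro a b ha hb d hd
    rw [map_add, ha d hd, hb d hd, add_zero]
  zero_mem' := by
    intro d _
    exact map_zero _
  smul_mem' := by
    intro c p hp d hd
    rw [smul_eq_mul, MvPowerSeries.coeff_mul]
    refine Finset.sum_eq_zero fun x hx => ?_
    have hx' : x.1 + x.2 = d := by simpa using hx
    have : x.2.degree ≤ d.degree := by
      rw [← hx', map_add]; exact Nat.le_add_left _ _
    rw [hp x.2 (by omega), mul_zero]

lemma mem_ordIdeal {N : ℕ} {p : R2} :
    p ∈ ordIdeal N ↔ ∀ d : Fin 2 →₀ ℕ, d.degree < N → MvPowerSeries.coeff d p = 0 := Iff.rfl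

lemma ordIdeal_zero : ordIdeal 0 = ⊤ := by
  rw [eq_top_iff]
  intro p _ d hd
  omega

lemma ordIdeal_anti {a b : ℕ} (h : a ≤ b) : ordIdeal b ≤ ordIdeal a := by
  intro p hp d hd
  exact hp d (by omega)

lemma X_mem_max (i : Fin 2) : (MvPowerSeries.X i : R2) ∈ IsLocalRing.maximalIdeal R2 := by
  rw [IsLocalRing.mem_maximalIdeal, mem_nonunits_iff, MvPowerSeries.isUnit_iff_constantCoeff]
  simp

lemma mem_smul_of_X_mul {j : ℕ} (i : Fin 2) (a : R2)
    (h : MvPowerSeries.X i * a ∈ ordIdeal (j + 1)) :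
    MvPowerSeries.X i * a ∈ IsLocalRing.maximalIdeal R2 • ordIdeal j := by
  refine Submodule.smul_mem_smul (X_mem_max i) ?_
  intro d hd
  have := h (Finsupp.single i 1 + d) (by rw [map_add, Finsupp.degree_single]; omega)
  rwa [MvPowerSeries.X_def, MvPowerSeries.coeff_add_monomial_mul, one_mul] at this

lemma ordIdeal_succ_le (j : ℕ) :
    ordIdeal (j + 1) ≤ IsLocalRing.maximalIdeal R2 • ordIdeal j := by
  intro p hp
  let p1 : R2 := fun d => if d 0 = 0 then 0 else MvPowerSeries.coeff d p
  let p2 : R2 := fun d => if d 0 = 0 then MvPowerSeries.coeff d p else 0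
  have c1 : ∀ d, MvPowerSeries.coeff d p1 = if d 0 = 0 then 0 else MvPowerSeries.coeff d p :=
    fun d => rfl
  have c2 : ∀ d, MvPowerSeries.coeff d p2 = if d 0 = 0 then MvPowerSeries.coeff d p else 0 :=
    fun d => rfl
  have hsum : p = p1 + p2 := by
    ext d
    rw [map_add, c1, c2]
    split_ifs <;> simp
  have h1 : (MvPowerSeries.X 0 : R2) ∣ p1 := by
    rw [MvPowerSeries.X_dvd_iff]
    intro m hm
    rw [c1, if_pos hm]
  have h2 : (MvPowerSeries.X 1 : R2) ∣ p2 := by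
    rw [MvPowerSeries.X_dvd_iff]
    intro m hm
    rw [c2]
    split_ifs with h0
    · apply hp
      have : m = 0 := by
        ext i
        fin_cases i
        · exact h0
        · exact hm
      simp [this]
    · rfl
  have m1 : p1 ∈ ordIdeal (j + 1) := by
    intro d hd
    rw [c1]
    split_ifs
    · rfl
    · exact hp d hd
  have m2 : p2 ∈ ordIdeal (j + 1) := by
    intro d hd
    rw [c2]
    split_ifs
    · exact hp d hd
    · rfl
  obtain ⟨a, ha⟩ := h1
  obtain ⟨b, hb⟩ := h2
  rw [hsum]
  refine Submodule.add_mem _ ?_ ?_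
  · rw [ha] at m1 ⊢
    exact mem_smul_of_X_mul 0 a m1
  · rw [hb] at m2 ⊢
    exact mem_smul_of_X_mul 1 b m2

lemma nakayama_step (J : Ideal R2) (j : ℕ) (h : ordIdeal j ≤ J ⊔ ordIdeal (j + 1)) :
    ordIdeal j ≤ J := by
  refine Submodule.le_of_le_smul_of_le_jacobson_bot (I := IsLocalRing.maximalIdeal R2)
    (IsNoetherian.noetherian _) (IsLocalRing.maximalIdeal_le_jacobson _) ?_
  exact h.trans (sup_le_sup_left (ordIdeal_succ_le j) J)

lemma finrank_quot_mono (J K : Ideal R2) (h : J ≤ K) [FiniteDimensional ℂ (R2 ⧸ J)] :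
    FiniteDimensional ℂ (R2 ⧸ K) ∧ Module.finrank ℂ (R2 ⧸ K) ≤ Module.finrank ℂ (R2 ⧸ J) ∧
      (Module.finrank ℂ (R2 ⧸ K) = Module.finrank ℂ (R2 ⧸ J) → J = K) := by
  let g : (R2 ⧸ J) →ₗ[ℂ] (R2 ⧸ K) := (Ideal.Quotient.factorₐ ℂ h).toLinearMap
  have hg : Function.Surjective g := Ideal.Quotient.factor_surjective h
  have hf : FiniteDimensional ℂ (R2 ⧸ K) := Module.Finite.of_surjective g hg
  refine ⟨hf, LinearMap.finrank_le_finrank_of_surjective hg, fun he => ?_⟩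
  have hinj : Function.Injective g :=
    (LinearMap.injective_iff_surjective_of_finrank_eq_finrank he.symm).2 hg
  refine le_antisymm h fun x hx => ?_
  rw [← Ideal.Quotient.eq_zero_iff_mem]
  apply hinj
  rw [map_zero]
  exact Ideal.Quotient.eq_zero_iff_mem.2 hx

lemma ordIdeal_le_of_finrank_lt (J : Ideal R2) [FiniteDimensional ℂ (R2 ⧸ J)] (N : ℕ)
    (h : Module.finrank ℂ (R2 ⧸ (J ⊔ ordIdeal N)) < N) : ordIdeal N ≤ J := by
  by_contra hN
  have key : ∀ i ≤ N, i ≤ Module.finrank ℂ (R2 ⧸ (J ⊔ ordIdeal i)) := by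
    intro i
    induction i with
    | zero => intro _; exact Nat.zero_le _
    | succ i ih =>
      intro hi
      have h1 := ih (by omega)
      have := (finrank_quot_mono J (J ⊔ ordIdeal (i + 1)) le_sup_left).1
      obtain ⟨_, hle, heq⟩ := finrank_quot_mono (J ⊔ ordIdeal (i + 1)) (J ⊔ ordIdeal i)
        (sup_le_sup_left (ordIdeal_anti (Nat.le_succ i)) J)
      rcases Nat.lt_or_ge i (Module.finrank ℂ (R2 ⧸ (J ⊔ ordIdeal (i + 1)))) with h2 | h2
      · exact h2
      · exfalso
        have h3 := heq (by omega)
        apply hN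
        refine (ordIdeal_anti (by omega : i ≤ N)).trans (nakayama_step J i ?_)
        rw [h3]
        exact le_sup_right
  have := key N le_rfl
  omega

/-- Exponents of total degree less than `N`. -/
abbrev Ex (N : ℕ) := {d : Fin 2 →₀ ℕ // d.degree < N}

instance (N : ℕ) : Finite (Ex N) :=
  Set.Finite.to_subtype ((Finsupp.finite_of_degree_le (σ := Fin 2) N).subset
    (fun d (hd : d.degree < N) => show d.degree ≤ N from le_of_lt hd))

noncomputable instance (N : ℕ) : Fintype (Ex N) := Fintype.ofFinite _

/-- Truncation of power series. -/
noncomputable def tr (N : ℕ) : R2 →ₗ[ℂ] (Ex N → ℂ) :=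
  LinearMap.pi fun t => MvPowerSeries.coeff t.1

lemma tr_apply (N : ℕ) (p : R2) (t : Ex N) : tr N p t = MvPowerSeries.coeff t.1 p := rfl

lemma tr_eq_zero {N : ℕ} {p : R2} : tr N p = 0 ↔ p ∈ ordIdeal N := by
  rw [mem_ordIdeal, funext_iff]
  exact ⟨fun h d hd => h ⟨d, hd⟩, fun h t => h t.1 t.2⟩

lemma tr_surj (N : ℕ) : Function.Surjective (tr N) := by
  classical
  intro v
  refine ⟨fun d => if h : d.degree < N then v ⟨d, h⟩ else 0, ?_⟩
  funext t
  change (if h : t.1.degree < N then v ⟨t.1, h⟩ else 0) = v t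
  rw [dif_pos t.2]

/-- The multiplication matrix of a pair of series, truncated at order `N`. -/
noncomputable def mat (N : ℕ) (P : Fin 2 → R2) : Matrix (Ex N) (Ex N × Fin 2) ℂ :=
  fun t u => MvPowerSeries.coeff t.1 (MvPowerSeries.monomial u.1.1 (1 : ℂ) * P u.2)

lemma mat_col (N : ℕ) (P : Fin 2 → R2) (u : Ex N × Fin 2) :
    (mat N P).col u = tr N (MvPowerSeries.monomial u.1.1 (1 : ℂ) * P u.2) := rfl

lemma tr_mul_mem (N : ℕ) (P : Fin 2 → R2) (a : R2) (i : Fin 2) :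
    tr N (a * P i) ∈ Submodule.span ℂ (Set.range (mat N P).col) := by
  classical
  let b : R2 := ∑ u : Ex N, MvPowerSeries.coeff u.1 a • MvPowerSeries.monomial u.1 (1 : ℂ)
  have hab : a - b ∈ ordIdeal N := by
    rw [← tr_eq_zero]
    funext t
    rw [tr_apply, map_sub, map_sum, Finset.sum_eq_single t]
    · simp
    · intro u _ hu
      have : t.1 ≠ u.1 := fun h => hu (Subtype.ext h.symm)
      simp [MvPowerSeries.coeff_monomial, this]
    · simp
  have h1 : tr N (a * P i) = tr N (b * P i) := by
    rw [← sub_eq_zero, ← map_sub, ← sub_mul, tr_eq_zero]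
    exact Ideal.mul_mem_right _ _ hab
  rw [h1, Finset.sum_mul, map_sum]
  refine Submodule.sum_mem _ fun u _ => ?_
  rw [smul_mul_assoc, map_smul]
  exact Submodule.smul_mem _ _ (Submodule.subset_span ⟨(u, i), rfl⟩)

lemma finrank_add_rank (N : ℕ) (P : Fin 2 → R2) :
    Module.finrank ℂ (R2 ⧸ (Ideal.span {P 0, P 1} ⊔ ordIdeal N)) + (mat N P).rank
      = Fintype.card (Ex N) := by
  set W := Submodule.span ℂ (Set.range (mat N P).col) with hW
  let ψ : R2 →ₗ[ℂ] ((Ex N → ℂ) ⧸ W) := W.mkQ ∘ₗ tr N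
  have hψ : Function.Surjective ψ := (Submodule.mkQ_surjective W).comp (tr_surj N)
  have hWJ : ∀ w ∈ W, ∃ q ∈ Ideal.span {P 0, P 1}, tr N q = w := by
    have : W ≤ Submodule.map (tr N) ((Ideal.span {P 0, P 1}).restrictScalars ℂ) := by
      rw [hW, Submodule.span_le]
      rintro _ ⟨u, rfl⟩
      refine ⟨_, ?_, (mat_col N P u).symm⟩
      refine Ideal.mul_mem_left _ _ (Ideal.subset_span ?_)
      obtain ⟨u, i⟩ := u
      fin_cases i <;> simp
    intro w hw
    exact this hw
  have hker : LinearMap.ker ψ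
      = (Ideal.span {P 0, P 1} ⊔ ordIdeal N).restrictScalars ℂ := by
    ext p
    rw [LinearMap.mem_ker, Submodule.restrictScalars_mem]
    change W.mkQ (tr N p) = 0 ↔ _
    rw [Submodule.mkQ_apply, Submodule.Quotient.mk_eq_zero]
    constructor
    · intro hp
      obtain ⟨q, hq, hqp⟩ := hWJ _ hp
      have h2 : p - q ∈ ordIdeal N := by
        rw [← tr_eq_zero, map_sub, hqp, sub_self]
      have := Submodule.add_mem_sup hq h2
      rwa [add_sub_cancel] at this
    · intro hp
      obtain ⟨q, hq, r, hr, rfl⟩ := Submodule.mem_sup.1 hp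
      obtain ⟨a, b, rfl⟩ := Ideal.mem_span_pair.1 hq
      rw [map_add, map_add, tr_eq_zero.2 hr, add_zero]
      exact Submodule.add_mem _ (tr_mul_mem N P a 0) (tr_mul_mem N P b 1)
  have e1 := (ψ.quotKerEquivOfSurjective hψ).finrank_eq
  rw [hker] at e1
  have e2 := (Submodule.Quotient.restrictScalarsEquiv ℂ
    (Ideal.span {P 0, P 1} ⊔ ordIdeal N)).finrank_eq
  have e3 := Submodule.finrank_quotient_add_finrank W
  rw [Matrix.rank_eq_finrank_span_cols, ← hW]
  rw [Module.finrank_fintype_fun_eq_card] at e3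
  omega

section Rank

variable {m n : Type} [Fintype m] [Fintype n]

lemma exists_cols (A : Matrix m n ℂ) (r : ℕ) (h : r ≤ A.rank) :
    ∃ g : Fin r → n, (A.submatrix id g).rank = r := by
  classical
  rw [Matrix.rank_eq_finrank_span_cols] at h
  obtain ⟨f, hf, -, hli⟩ := Submodule.exists_fun_fin_finrank_span_eq ℂ (Set.range A.col)
  choose g hg using hf
  refine ⟨g ∘ Fin.castLE h, ?_⟩
  have h1 : LinearIndependent ℂ (f ∘ Fin.castLE h) :=
    hli.comp _ (Fin.castLE_injective h)
  have h2 : (A.submatrix id (g ∘ Fin.castLE h)).col = f ∘ Fin.castLE h := by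
    funext k
    exact hg (Fin.castLE h k)
  rw [Matrix.rank_eq_finrank_span_cols, h2, finrank_span_eq_card h1, Fintype.card_fin]

lemma le_rank_iff (A : Matrix m n ℂ) (r : ℕ) :
    r ≤ A.rank ↔ ∃ (e : Fin r → m) (g : Fin r → n), (A.submatrix e g).det ≠ 0 := by
  classical
  constructor
  · intro h
    obtain ⟨g, hg⟩ := exists_cols A r h
    obtain ⟨e, he⟩ := exists_cols (A.submatrix id g).transpose r
      (by rw [Matrix.rank_transpose, hg])
    refine ⟨e, g, fun h0 => ?_⟩
    have h3 : ((A.submatrix id g).transpose.submatrix id e) = (A.submatrix e g).transpose := rfl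
    rw [h3, Matrix.rank_transpose] at he
    obtain ⟨v, hv, hv0⟩ := Matrix.exists_mulVec_eq_zero_iff.2 h0
    have h4 := LinearMap.finrank_range_add_finrank_ker (A.submatrix e g).mulVecLin
    rw [Module.finrank_fintype_fun_eq_card, Fintype.card_fin] at h4
    have h5 : Module.finrank ℂ (LinearMap.range (A.submatrix e g).mulVecLin) = r := he
    have h6 : LinearMap.ker (A.submatrix e g).mulVecLin = ⊥ :=
      Submodule.finrank_eq_zero.1 (by omega)
    apply hv
    have : v ∈ LinearMap.ker (A.submatrix e g).mulVecLin := by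
      rw [LinearMap.mem_ker]; exact hv0
    rw [h6] at this
    simpa using this
  · rintro ⟨e, g, h⟩
    have h1 := Matrix.rank_of_det_ne_zero h
    rw [Fintype.card_fin] at h1
    rw [← h1]
    exact Matrix.rank_submatrix_le _ _ _

lemma rank_analytic (B : ℝ → Matrix m n ℂ)
    (hB : ∀ i j, AnalyticAt ℝ (fun s => B s i j) 0) :
    ∃ c, (B 0).rank ≤ c ∧ ∀ᶠ s in 𝓝[>] (0 : ℝ), (B s).rank = c := by
  classical
  have hdet : ∀ (r : ℕ) (e : Fin r → m) (g : Fin r → n),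
      AnalyticAt ℝ (fun s => ((B s).submatrix e g).det) 0 := by
    intro r e g
    simp only [Matrix.det_apply, Matrix.submatrix_apply]
    refine Finset.analyticAt_fun_sum _ fun σ _ => ?_
    have : AnalyticAt ℝ (fun s => ∏ i, B s (e (σ i)) (g i)) 0 :=
      Finset.analyticAt_fun_prod _ fun i _ => hB _ _
    rcases Int.units_eq_one_or (Equiv.Perm.sign σ) with h | h
    · simpa [h] using this
    · have h2 := this.fun_neg
      simp only [h, Units.neg_smul, one_smul]
      exact h2
  have hle : 𝓝[>] (0 : ℝ) ≤ 𝓝[≠] 0 := nhdsWithin_mono _ fun x hx => ne_of_gt hx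
  have hdich : ∀ r, (∀ᶠ s in 𝓝[>] (0 : ℝ), r ≤ (B s).rank) ∨
      (∀ᶠ s in 𝓝[>] (0 : ℝ), ¬ r ≤ (B s).rank) := by
    intro r
    by_cases hex : ∃ (e : Fin r → m) (g : Fin r → n),
        ∀ᶠ s in 𝓝[≠] (0 : ℝ), ((B s).submatrix e g).det ≠ 0
    · left
      obtain ⟨e, g, h⟩ := hex
      filter_upwards [hle h] with s hs
      exact (le_rank_iff _ _).2 ⟨e, g, hs⟩
    · right
      have : ∀ (e : Fin r → m) (g : Fin r → n),
          ∀ᶠ s in 𝓝[>] (0 : ℝ), ((B s).submatrix e g).det = 0 := by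
        intro e g
        rcases (hdet r e g).eventually_eq_zero_or_eventually_ne_zero with h | h
        · exact h.filter_mono nhdsWithin_le_nhds
        · exact absurd ⟨e, g, h⟩ hex
      have h2 := eventually_all.2 fun e => eventually_all.2 (this e)
      filter_upwards [h2] with s hs hr
      obtain ⟨e, g, h⟩ := (le_rank_iff _ _).1 hr
      exact h (hs e g)
  have h0 : ∀ᶠ s in 𝓝[>] (0 : ℝ), (B 0).rank ≤ (B s).rank := by
    obtain ⟨e, g, h⟩ := (le_rank_iff (B 0) _).1 le_rfl
    have := (hdet _ e g).continuousAt.eventually_ne h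
    filter_upwards [this.filter_mono nhdsWithin_le_nhds] with s hs
    exact (le_rank_iff _ _).2 ⟨e, g, hs⟩
  let S := fun r => ∀ᶠ s in 𝓝[>] (0 : ℝ), r ≤ (B s).rank
  have hbd : ∀ r, S r → r ≤ Fintype.card m := by
    intro r hr
    obtain ⟨s, hs⟩ := Eventually.exists hr
    exact hs.trans (Matrix.rank_le_card_height _)
  let c := Nat.findGreatest S (Fintype.card m)
  have hc : S c := Nat.findGreatest_spec (P := S) (hbd _ h0) h0
  refine ⟨c, Nat.le_findGreatest (hbd _ h0) h0, ?_⟩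
  have hn : ¬ S (c + 1) := fun h => by
    have := Nat.le_findGreatest (P := S) (hbd _ h) h
    change c + 1 ≤ c at this
    omega
  have h3 := (hdich (c + 1)).resolve_left hn
  filter_upwards [hc, h3] with s h4 h5
  omega

end Rank

/-- The pair of partial derivatives, as power series. -/
noncomputable def grad (f : MvPolynomial (Fin 2) ℂ) (i : Fin 2) : R2 :=
  ((pderiv i f : MvPolynomial (Fin 2) ℂ) : MvPowerSeries (Fin 2) ℂ)

lemma mat_apply (N : ℕ) (f : MvPolynomial (Fin 2) ℂ) (t : Ex N) (u : Ex N × Fin 2) :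
    mat N (grad f) t u = if u.1.1 ≤ t.1 then
      coeff (t.1 - u.1.1 + Finsupp.single u.2 1) f * (((t.1 - u.1.1) u.2 : ℂ) + 1) else 0 := by
  classical
  rw [mat, MvPowerSeries.coeff_monomial_mul, one_mul, grad, MvPolynomial.coeff_coe, coeff_pderiv]

lemma jacobianIdeal_eq (f : MvPolynomial (Fin 2) ℂ) :
    jacobianIdeal f = Ideal.span {grad f 0, grad f 1} := rfl

lemma milnor_eq (f : MvPolynomial (Fin 2) ℂ) (hf : IsIsolatedSingularity f) (N : ℕ)
    (h : Fintype.card (Ex N) < N + (mat N (grad f)).rank) :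
    milnor f + (mat N (grad f)).rank = Fintype.card (Ex N) := by
  have : FiniteDimensional ℂ (R2 ⧸ jacobianIdeal f) := hf.2.2.2
  have h1 := finrank_add_rank N (grad f)
  rw [← jacobianIdeal_eq] at h1
  have h2 := ordIdeal_le_of_finrank_lt (jacobianIdeal f) N (by omega)
  rw [sup_eq_left.2 h2] at h1
  exact h1

end MilnorAux

open MilnorAux Filter Topology

/-- Upper semicontinuity of the Milnor number in an analytic deformation
`(f_s)_{s ∈ [0,1]}` of isolated singularities: for sufficiently small `s` one has
`μ(f_s) ≤ μ(f₀)`, and `μ(f_s)` is constant for sufficiently small `s ≠ 0`. -/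
theorem milnor_upper_semicontinuous (f : ℝ → MvPolynomial (Fin 2) ℂ)
    (hanal : ∀ m : Fin 2 →₀ ℕ,
      AnalyticOn ℝ (fun s => coeff m (f s)) (Set.Icc (0:ℝ) 1))
    (hiso : ∀ s ∈ Set.Icc (0:ℝ) 1, IsIsolatedSingularity (f s)) :
    ∃ ε > (0:ℝ), (∀ s : ℝ, 0 ≤ s → s < ε → milnor (f s) ≤ milnor (f 0)) ∧
      ∀ s t : ℝ, 0 < s → s < ε → 0 < t → t < ε → milnor (f s) = milnor (f t) := by
  have h01 : (0 : ℝ) ∈ Set.Icc (0 : ℝ) 1 := by simp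
  obtain ⟨N, hN⟩ : ∃ N, N = milnor (f 0) + 1 := ⟨_, rfl⟩
  choose g hg0 hg hga using fun d => (hanal d 0 h01).exists_analyticAt
  have hgeq : ∀ d, ∀ s ∈ Set.Icc (0 : ℝ) 1, coeff d (f s) = g d s :=
    fun d s hs => hg d (Set.mem_insert_of_mem _ hs)
  let B : ℝ → Matrix (Ex N) (Ex N × Fin 2) ℂ := fun s t u =>
    if u.1.1 ≤ t.1 then
      g (t.1 - u.1.1 + Finsupp.single u.2 1) s * (((t.1 - u.1.1) u.2 : ℂ) + 1) else 0
  have hBf : ∀ s ∈ Set.Icc (0 : ℝ) 1, B s = mat N (grad (f s)) := by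
    intro s hs
    ext t u
    rw [mat_apply, hgeq _ s hs]
  have hBan : ∀ t u, AnalyticAt ℝ (fun s => B s t u) 0 := by
    intro t u
    by_cases h : u.1.1 ≤ t.1
    · simp only [B, if_pos h]
      exact (hga _).mul analyticAt_const
    · simp only [B, if_neg h]
      exact analyticAt_const
  obtain ⟨c, hc0, hc⟩ := rank_analytic B hBan
  -- the special fibre
  have : FiniteDimensional ℂ (R2 ⧸ jacobianIdeal (f 0)) := (hiso 0 h01).2.2.2
  have hle := (finrank_quot_mono (jacobianIdeal (f 0)) (jacobianIdeal (f 0) ⊔ ordIdeal N)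
    le_sup_left).2.1
  change _ ≤ milnor (f 0) at hle
  have hfr := finrank_add_rank N (grad (f 0))
  rw [← jacobianIdeal_eq] at hfr
  have hm0 := milnor_eq (f 0) (hiso 0 h01) N (by omega)
  rw [hBf 0 h01] at hc0
  -- the nearby fibres
  obtain ⟨δ, hδ, hδc⟩ := mem_nhdsGT_iff_exists_Ioo_subset.1 hc
  have hδ0 : (0 : ℝ) < δ := hδ
  have key : ∀ s : ℝ, 0 < s → s < min δ 1 → milnor (f s) + c = Fintype.card (Ex N) := by
    intro s hs0 hs1
    have hsI : s ∈ Set.Icc (0 : ℝ) 1 := ⟨hs0.le, (hs1.trans_le (min_le_right _ _)).le⟩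
    have h1 : (B s).rank = c := hδc ⟨hs0, hs1.trans_le (min_le_left _ _)⟩
    rw [hBf s hsI] at h1
    have h2 := milnor_eq (f s) (hiso s hsI) N (by omega)
    omega
  refine ⟨min δ 1, lt_min hδ0 one_pos, ?_, ?_⟩
  · intro s hs0 hs1
    rcases hs0.eq_or_lt with h | h
    · rw [← h]
    · have := key s h hs1
      omega
  · intro s t hs0 hs1 ht0 ht1
    have h1 := key s hs0 hs1
    have h2 := key t ht0 ht1
    omega
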